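/- arXiv:1504.04879 — 5 statements merged into one kernel-verified Lean document; each statement's English description precedes it below -/
import Mathlib

section
/- Let n ≥ 2 and 1 ≤ k ≤ n. In the polynomial ring R = MvPolynomial (Fin n) ℤ, let W be the multiset of polynomials ∑_{i∈S} X_i indexed by the k-element subsets S of Fin n (i.e., the Chern roots of the k-th exterior power Λ^k γ_n of the standard representation). Then the second elementary symmetric function of W is congruent to (n−2 choose k−1)·e₂ modulo the ideal of R generated by e₁; equivalently, c₂(Λ^k γ_n) = (n−2 choose k−1)·c₂(γ_n) in H⁴(BSL_n, ℤ). In particular c₂(Λ²γ₄)=2c₂, c₂(Λ²γ₆)=4c₂, c₂(Λ³γ₆)=6c₂, c₂(Λ²γ₈)=6c₂, c₂(Λ⁴γ₈)=20c₂, c₂(Λ⁶γ₈)=6c₂, c₂(Λ³γ₉)=21c₂ and c₂(Λ⁶γ₉)=21c₂, as used in the paper. -/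
open MvPolynomial

/-- The multiset of Chern roots of the `k`-th exterior power of the standard
representation of `SL n`: for each `k`-element subset `S` of `Fin n`, the
polynomial `∑_{i ∈ S} X i`. -/
noncomputable def exteriorWeights (n k : ℕ) : Multiset (MvPolynomial (Fin n) ℤ) :=
  ((Finset.univ : Finset (Fin n)).powersetCard k).val.map
    (fun S => ∑ i ∈ S, MvPolynomial.X i)

namespace Multiset

theorem esymm_cons {R : Type*} [CommSemiring R] (a : R) (s : Multiset R) (n : ℕ) :
    (a ::ₘ s).esymm (n + 1) = s.esymm (n + 1) + a * s.esymm n := by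
  simp [esymm, powersetCard_cons, sum_map_mul_left]

theorem esymm_one_eq_sum {R : Type*} [CommSemiring R] (s : Multiset R) : s.esymm 1 = s.sum := by
  simp [esymm, powersetCard_one]

/-- The square of a sum is the sum of the squares plus twice the second elementary symmetric
function. -/
theorem sum_sq_eq_sum_map_sq_add {R : Type*} [CommSemiring R] (s : Multiset R) :
    s.sum ^ 2 = (s.map (· ^ 2)).sum + 2 * s.esymm 2 := by
  induction s using Multiset.induction with
  | empty => simp [esymm, show powersetCard 2 (0 : Multiset R) = 0 from powersetCard_zero_right 1]
  | cons a s ih =>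
    rw [sum_cons, map_cons, sum_cons, esymm_cons, esymm_one_eq_sum, add_sq, ih]
    ring

end Multiset

namespace Finset

variable {σ R : Type*} [Fintype σ] [DecidableEq σ] [CommRing R]

theorem card_filter_mem_powersetCard_univ (k : ℕ) (i : σ) :
    #{S ∈ (univ : Finset σ).powersetCard (k + 1) | i ∈ S} = (Fintype.card σ - 1).choose k := by
  simpa using card_filter_powersetCard_subset {i} (univ : Finset σ) (k + 1) (by simp) (by simp)

theorem card_filter_pair_mem_powersetCard_univ (k : ℕ) {i j : σ} (hij : i ≠ j) :
    #{S ∈ (univ : Finset σ).powersetCard (k + 1) | i ∈ S ∧ j ∈ S} + (Fintype.card σ - 2).choose k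
      = (Fintype.card σ - 1).choose k := by
  have hσ : 2 ≤ Fintype.card σ := by
    simpa [card_pair hij] using card_le_univ ({i, j} : Finset σ)
  obtain ⟨m, hm⟩ := Nat.exists_eq_add_of_le' hσ
  cases k with
  | zero =>
    suffices ∀ S ∈ (univ : Finset σ).powersetCard 1, ¬ (i ∈ S ∧ j ∈ S) by
      simpa [filter_eq_empty_iff] using this
    rintro S hS ⟨hi, hj⟩
    exact hij (card_le_one.mp (mem_powersetCard.mp hS).2.le i hi j hj)
  | succ k =>
    have h := card_filter_powersetCard_subset {i, j} (univ : Finset σ) (k + 2) (by simp)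
      (by simp [card_pair hij])
    simp only [insert_subset_iff, singleton_subset_iff, card_pair hij, card_univ] at h
    rw [h, hm]
    exact (Nat.choose_succ_succ m k).symm

theorem sum_powersetCard_univ_sum (k : ℕ) (f : σ → R) :
    ∑ S ∈ (univ : Finset σ).powersetCard (k + 1), ∑ i ∈ S, f i
      = (Fintype.card σ - 1).choose k * ∑ i, f i := by
  calc _ = ∑ S ∈ (univ : Finset σ).powersetCard (k + 1), ∑ i, if i ∈ S then f i else 0 := by simp
    _ = _ := by
      rw [sum_comm, mul_sum]
      refine sum_congr rfl fun i _ => ?_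
      rw [← sum_filter, sum_const, card_filter_mem_powersetCard_univ, nsmul_eq_mul]

theorem sum_powersetCard_univ_sum_sq (k : ℕ) (f : σ → R) :
    ∑ S ∈ (univ : Finset σ).powersetCard (k + 1), (∑ i ∈ S, f i) ^ 2
      = ((Fintype.card σ - 1).choose k - (Fintype.card σ - 2).choose k : R) * (∑ i, f i) ^ 2
        + (Fintype.card σ - 2).choose k * ∑ i, f i ^ 2 := by
  set B := ((Fintype.card σ - 1).choose k : R)
  set A := ((Fintype.card σ - 2).choose k : R)
  have key (i j : σ) :
      (#{S ∈ (univ : Finset σ).powersetCard (k + 1) | i ∈ S ∧ j ∈ S} : R)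
        = (B - A) + if i = j then A else 0 := by
    split_ifs with h
    · subst h
      simp [B, card_filter_mem_powersetCard_univ]
    · rw [add_zero, eq_sub_iff_add_eq]
      simpa [A, B] using congrArg (Nat.cast : ℕ → R) (card_filter_pair_mem_powersetCard_univ k h)
  calc _ = ∑ S ∈ (univ : Finset σ).powersetCard (k + 1),
        ∑ i, ∑ j, if i ∈ S ∧ j ∈ S then f i * f j else 0 := by
        simp [sq, sum_mul_sum, ite_and]
    _ = ∑ i, ∑ j, ((B - A) + if i = j then A else 0) * (f i * f j) := by
        rw [sum_comm]
        refine sum_congr rfl fun i _ => ?_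
        rw [sum_comm]
        refine sum_congr rfl fun j _ => ?_
        rw [← sum_filter, sum_const, nsmul_eq_mul, key]
    _ = _ := by
        rw [sq, sum_mul_sum]
        simp [add_mul, sum_add_distrib, sq, mul_sum]

end Finset

/-- Twice the second elementary symmetric function of the sums of `f` over the `(k + 1)`-element
subsets, in terms of the first two elementary symmetric functions of `f`. -/
theorem two_mul_esymm_two_subset_sums {σ R : Type*} [Fintype σ] [CommRing R] (k : ℕ) (f : σ → R) :
    2 * (((Finset.univ : Finset σ).powersetCard (k + 1)).val.map (fun S => ∑ i ∈ S, f i)).esymm 2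
      = 2 * ((Fintype.card σ - 2).choose k * (Finset.univ.val.map f).esymm 2)
        + ((Fintype.card σ - 1).choose k * ((Fintype.card σ - 1).choose k - 1) : R)
          * (∑ i, f i) ^ 2 := by
  classical
  have h₁ := Multiset.sum_sq_eq_sum_map_sq_add
    (((Finset.univ : Finset σ).powersetCard (k + 1)).val.map (fun S => ∑ i ∈ S, f i))
  have h₂ := Multiset.sum_sq_eq_sum_map_sq_add ((Finset.univ : Finset σ).val.map f)
  rw [Multiset.map_map] at h₁ h₂
  change (∑ S ∈ (Finset.univ : Finset σ).powersetCard (k + 1), ∑ i ∈ S, f i) ^ 2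
    = ∑ S ∈ (Finset.univ : Finset σ).powersetCard (k + 1), (∑ i ∈ S, f i) ^ 2 + _ at h₁
  change (∑ i, f i) ^ 2 = ∑ i, f i ^ 2 + _ at h₂
  rw [Finset.sum_powersetCard_univ_sum, Finset.sum_powersetCard_univ_sum_sq] at h₁
  linear_combination -h₁ + ((Fintype.card σ - 2).choose k : R) * h₂

/-- `c₂(Λ^k γ_n) = (n-2 choose k-1) · c₂(γ_n)`: the second elementary symmetric
function of the weights of `Λ^k γ_n` is congruent to `(n-2).choose (k-1)` times
`e₂` modulo the ideal generated by `e₁`.  In particular `c₂(Λ²γ₄) = 2c₂`,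
`c₂(Λ²γ₆) = 4c₂`, `c₂(Λ³γ₆) = 6c₂`, `c₂(Λ²γ₈) = 6c₂`, `c₂(Λ⁴γ₈) = 20c₂`,
`c₂(Λ⁶γ₈) = 6c₂`, `c₂(Λ³γ₉) = 21c₂` and `c₂(Λ⁶γ₉) = 21c₂`. -/
theorem c2_exterior_power (n k : ℕ) (hn : 2 ≤ n) (hk1 : 1 ≤ k) (hkn : k ≤ n) :
    (Multiset.esymm (exteriorWeights n k) 2
        - ((n - 2).choose (k - 1) : MvPolynomial (Fin n) ℤ) * esymm (Fin n) ℤ 2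
      ∈ Ideal.span {esymm (Fin n) ℤ 1})
    ∧ (Nat.choose (4 - 2) (2 - 1) = 2)
    ∧ (Nat.choose (6 - 2) (2 - 1) = 4)
    ∧ (Nat.choose (6 - 2) (3 - 1) = 6)
    ∧ (Nat.choose (8 - 2) (2 - 1) = 6)
    ∧ (Nat.choose (8 - 2) (4 - 1) = 20)
    ∧ (Nat.choose (8 - 2) (6 - 1) = 6)
    ∧ (Nat.choose (9 - 2) (3 - 1) = 21)
    ∧ (Nat.choose (9 - 2) (6 - 1) = 21) := by
  refine ⟨?_, by decide, by decide, by decide, by decide, by decide, by decide, by decide,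
    by decide⟩
  obtain ⟨k, rfl⟩ := Nat.exists_eq_add_of_le' hk1
  have h := two_mul_esymm_two_subset_sums k (X : Fin n → MvPolynomial (Fin n) ℤ)
  rw [Fintype.card_fin, ← esymm_eq_multiset_esymm, ← esymm_one] at h
  obtain ⟨c, hc⟩ := (Int.even_mul_pred_self ((n - 1).choose k)).two_dvd
  have hc' : ((n - 1).choose k * ((n - 1).choose k - 1) : MvPolynomial (Fin n) ℤ) = 2 * c := by
    exact_mod_cast congrArg (Int.cast : ℤ → MvPolynomial (Fin n) ℤ) hc
  rw [hc'] at h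
  refine Ideal.mem_span_singleton'.mpr ⟨c * esymm (Fin n) ℤ 1, ?_⟩
  refine mul_left_cancel₀ (two_ne_zero (α := MvPolynomial (Fin n) ℤ)) ?_
  rw [exteriorWeights, Nat.add_sub_cancel]
  linear_combination -h
end

section
/- Let n ≥ 2. In R = MvPolynomial (Fin n) ℤ, let W be the multiset of polynomials X_i − X_j over all ordered pairs (i, j) with i ≠ j (the nonzero weights of the adjoint representation of PGL_n; the n−1 zero weights contribute nothing). Then the second elementary symmetric function of W is congruent to 2n·e₂ modulo the ideal of R generated by e₁; equivalently, c₂(Ad_{PGL_n}) = 2n·c₂(γ_n) in H⁴(BSL_n, ℤ), the fact from Woodward used to prove that Chern classes generate H⁴(BPGL_n, ℤ) for n even. -/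
open MvPolynomial

/-- The multiset of nonzero weights of the adjoint representation of `PGL n`:
the polynomials `X i - X j` over all ordered pairs `(i, j)` with `i ≠ j`. -/
noncomputable def adjointWeights (n : ℕ) : Multiset (MvPolynomial (Fin n) ℤ) :=
  ((Finset.univ : Finset (Fin n × Fin n)).filter (fun p => p.1 ≠ p.2)).val.map
    (fun p => MvPolynomial.X p.1 - MvPolynomial.X p.2)

/-- The square of the sum of a multiset, split into squares and products of pairs. -/
theorem Multiset.sum_sq_eq_sum_map_sq_add_two_mul_esymm {R : Type*} [CommRing R]
    (s : Multiset R) :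
    s.sum ^ 2 = (s.map (· ^ 2)).sum + 2 * s.esymm 2 := by
  induction s using Multiset.induction with
  | empty => simp [Multiset.esymm, Multiset.powersetCard_zero_right 1]
  | cons a s ih =>
    have h : (a ::ₘ s).esymm 2 = s.esymm 2 + a * s.sum := by
      simp [Multiset.esymm, Multiset.powersetCard_cons, Multiset.powersetCard_one]
      simpa using Multiset.sum_map_mul_left (s := s) (a := a) (f := id)
    rw [h, Multiset.sum_cons, Multiset.map_cons, Multiset.sum_cons]
    linear_combination ih

theorem sum_adjointWeights (n : ℕ) : (adjointWeights n).sum = 0 := by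
  change ∑ p ∈ (Finset.univ : Finset (Fin n × Fin n)).filter (fun p => p.1 ≠ p.2),
    (X p.1 - X p.2 : MvPolynomial (Fin n) ℤ) = 0
  rw [Finset.sum_filter_of_ne (fun p _ h (hp : p.1 = p.2) => h (by rw [hp, sub_self])),
    Fintype.sum_prod_type]
  simp [Finset.sum_sub_distrib, Finset.mul_sum]

theorem sum_map_sq_adjointWeights (n : ℕ) :
    ((adjointWeights n).map (· ^ 2)).sum =
      2 * ((n : MvPolynomial (Fin n) ℤ) * ∑ i, X i ^ 2 - (∑ i, X i) ^ 2) := by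
  rw [adjointWeights, Multiset.map_map]
  change ∑ p ∈ (Finset.univ : Finset (Fin n × Fin n)).filter (fun p => p.1 ≠ p.2),
    (X p.1 - X p.2 : MvPolynomial (Fin n) ℤ) ^ 2 = _
  rw [Finset.sum_filter_of_ne
    (fun p _ h (hp : p.1 = p.2) => h (by rw [hp, sub_self, zero_pow two_ne_zero])),
    Fintype.sum_prod_type]
  simp only [sub_sq, Finset.sum_add_distrib, Finset.sum_sub_distrib, Finset.sum_const,
    Finset.card_univ, Fintype.card_fin, nsmul_eq_mul, ← Finset.mul_sum, ← Finset.sum_mul]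
  ring

/-- The exact value of the second elementary symmetric function of the adjoint weights. -/
theorem esymm_two_adjointWeights (n : ℕ) :
    (adjointWeights n).esymm 2 =
      2 * (n : MvPolynomial (Fin n) ℤ) * esymm (Fin n) ℤ 2
        + (1 - n) * esymm (Fin n) ℤ 1 ^ 2 := by
  have hW := Multiset.sum_sq_eq_sum_map_sq_add_two_mul_esymm (adjointWeights n)
  rw [sum_adjointWeights, sum_map_sq_adjointWeights] at hW
  have hX := Multiset.sum_sq_eq_sum_map_sq_add_two_mul_esymm
    ((Finset.univ : Finset (Fin n)).val.map (X : Fin n → MvPolynomial (Fin n) ℤ))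
  rw [← esymm_eq_multiset_esymm, Multiset.map_map] at hX
  change (∑ i, X i) ^ 2 = (∑ i, X i ^ 2) + _ at hX
  rw [esymm_one]
  refine mul_left_cancel₀ (two_ne_zero (α := MvPolynomial (Fin n) ℤ)) ?_
  linear_combination -hW + 2 * (n : MvPolynomial (Fin n) ℤ) * hX

/-- `c₂(Ad_{PGL_n}) = 2n · c₂(γ_n)`: the second elementary symmetric function of
the nonzero weights of the adjoint representation is congruent to `2n · e₂`
modulo the ideal generated by `e₁`. -/
theorem c2_adjoint (n : ℕ) (hn : 2 ≤ n) :
    Multiset.esymm (adjointWeights n) 2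
        - 2 * (n : MvPolynomial (Fin n) ℤ) * esymm (Fin n) ℤ 2
      ∈ Ideal.span {esymm (Fin n) ℤ 1} := by
  rw [esymm_two_adjointWeights, add_sub_cancel_left, Ideal.mem_span_singleton]
  exact Dvd.dvd.mul_left (dvd_pow_self _ two_ne_zero) _
end

section
/- Let n ≥ 2. In R = MvPolynomial (Fin n) ℤ, let W be the multiset of polynomials X_i + X_j over all unordered pairs i ≤ j in Fin n (the weights of the symmetric square Sym²γ_n of the standard representation). Then the second elementary symmetric function of W is congruent to (n+2)·e₂ modulo the ideal of R generated by e₁; equivalently, c₂(Sym²γ_n) = (n+2)·c₂(γ_n) in H⁴(BSL_n, ℤ). -/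
open MvPolynomial

/-- The multiset of weights of the symmetric square `Sym² γ_n` of the standard
representation of `SL n`: the polynomials `X i + X j` over all unordered pairs
`i ≤ j` in `Fin n`. -/
noncomputable def symSqWeights (n : ℕ) : Multiset (MvPolynomial (Fin n) ℤ) :=
  ((Finset.univ : Finset (Fin n × Fin n)).filter (fun p => p.1 ≤ p.2)).val.map
    (fun p => MvPolynomial.X p.1 + MvPolynomial.X p.2)

/-- Twice the sum of a symmetric function over the pairs `i ≤ j` is its sum over all pairs plus
its sum over the diagonal. -/
theorem Finset.two_mul_sum_filter_le_eq {ι R : Type*} [Fintype ι] [LinearOrder ι] [CommRing R]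
    (f : ι → ι → R) (hf : ∀ i j, f i j = f j i) :
    2 * ∑ p : ι × ι with p.1 ≤ p.2, f p.1 p.2 = ∑ i, ∑ j, f i j + ∑ i, f i i := by
  have h : ∑ p : ι × ι with p.1 ≤ p.2, f p.1 p.2 = ∑ i, ∑ j, if i ≤ j then f i j else 0 := by
    rw [Finset.sum_filter, Fintype.sum_prod_type]
  have h' : ∑ i, ∑ j, (if i ≤ j then f i j else 0) = ∑ i, ∑ j, if j ≤ i then f i j else 0 := by
    rw [Finset.sum_comm]
    simp only [hf]
  have hdiag : ∑ i, f i i = ∑ i, ∑ j, if i = j then f i j else 0 := by simp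
  rw [two_mul, h]
  nth_rewrite 2 [h']
  rw [hdiag]
  simp only [← Finset.sum_add_distrib]
  refine Finset.sum_congr rfl fun i _ => Finset.sum_congr rfl fun j _ => ?_
  rcases lt_trichotomy i j with hij | rfl | hij
  · simp [hij.le, hij.not_ge, hij.ne]
  · simp
  · simp [hij.le, hij.not_ge, hij.ne']

theorem sum_symSqWeights (n : ℕ) :
    (symSqWeights n).sum = ((n : MvPolynomial (Fin n) ℤ) + 1) * esymm (Fin n) ℤ 1 := by
  refine mul_left_cancel₀ (two_ne_zero (α := MvPolynomial (Fin n) ℤ)) ?_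
  refine (Finset.two_mul_sum_filter_le_eq (fun i j : Fin n => (X i + X j : MvPolynomial (Fin n) ℤ))
    fun i j => add_comm _ _).trans ?_
  simp only [Finset.sum_add_distrib, Finset.sum_const, Finset.card_univ, Fintype.card_fin,
    nsmul_eq_mul, ← Finset.mul_sum, esymm_one]
  ring

theorem sum_map_sq_symSqWeights (n : ℕ) :
    ((symSqWeights n).map (· ^ 2)).sum =
      ((n : MvPolynomial (Fin n) ℤ) + 2) * psum (Fin n) ℤ 2 + esymm (Fin n) ℤ 1 ^ 2 := by
  refine mul_left_cancel₀ (two_ne_zero (α := MvPolynomial (Fin n) ℤ)) ?_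
  rw [symSqWeights, Multiset.map_map]
  refine (Finset.two_mul_sum_filter_le_eq
    (fun i j : Fin n => ((X i + X j) ^ 2 : MvPolynomial (Fin n) ℤ))
    fun i j => by rw [add_comm]).trans ?_
  simp only [add_sq, mul_assoc, Finset.sum_add_distrib, Finset.sum_const, Finset.card_univ,
    Fintype.card_fin, nsmul_eq_mul, ← Finset.mul_sum, ← Finset.sum_mul, esymm_one, psum, ← sq]
  ring

theorem esymm_one_sq_eq_psum_two_add (n : ℕ) :
    esymm (Fin n) ℤ 1 ^ 2 = psum (Fin n) ℤ 2 + 2 * esymm (Fin n) ℤ 2 := by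
  have h := Multiset.sum_sq_eq_sum_map_sq_add_two_mul_esymm
    ((Finset.univ : Finset (Fin n)).val.map (X : Fin n → MvPolynomial (Fin n) ℤ))
  rw [← esymm_eq_multiset_esymm, Multiset.map_map] at h
  rw [esymm_one]
  exact h

/-- `c₂(Sym² γ_n) = (n + 2) · c₂(γ_n)`: the second elementary symmetric function
of the weights of `Sym² γ_n` is congruent to `(n + 2) · e₂` modulo the ideal
generated by `e₁`. -/
theorem c2_sym_square (n : ℕ) (hn : 2 ≤ n) :
    Multiset.esymm (symSqWeights n) 2
        - ((n : MvPolynomial (Fin n) ℤ) + 2) * esymm (Fin n) ℤ 2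
      ∈ Ideal.span {esymm (Fin n) ℤ 1} := by
  obtain ⟨k, hk⟩ := Nat.even_mul_succ_self n
  have hk' : (n : MvPolynomial (Fin n) ℤ) * (n + 1) = k + k := by exact_mod_cast hk
  have h := Multiset.sum_sq_eq_sum_map_sq_add_two_mul_esymm (symSqWeights n)
  rw [sum_symSqWeights, sum_map_sq_symSqWeights] at h
  refine Ideal.mem_span_singleton'.mpr ⟨((k : MvPolynomial (Fin n) ℤ) - 1) * esymm (Fin n) ℤ 1, ?_⟩
  refine mul_left_cancel₀ (two_ne_zero (α := MvPolynomial (Fin n) ℤ)) ?_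
  linear_combination h - esymm (Fin n) ℤ 1 ^ 2 * hk' -
    ((n : MvPolynomial (Fin n) ℤ) + 2) * esymm_one_sq_eq_psum_two_add n
end

section
/- In R = MvPolynomial (Fin 6) ℤ, the second elementary symmetric function of the multiset W((2,1), 6) of weights of semistandard Young tableaux of shape (2,1) with entries in {0,…,5} is congruent to 33·e₂ modulo the ideal generated by e₁; equivalently, c₂(γ₆^{(2,1)}) = 33·c₂(γ₆) in H⁴(BSL₆, ℤ), the computation used in Proposition 2.2 to show that Chern classes of representations generate H⁴(B(SL₆/μ₃), ℤ) = ℤ·3c₂. -/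
open MvPolynomial

open scoped Classical in
/-- The multiset `W(lam, n)` of weights of semistandard Young tableaux of shape
`lam` (a list of row lengths) with entries in `{0, …, n-1}`: a tableau assigns
to each cell `(i, j)` of the Young diagram of `lam` an entry in `Fin n`, weakly
increasing along rows and strictly increasing down columns; its weight is the
sum `∑_{(i,j) ∈ lam} X_{T(i,j)}`. -/
noncomputable def ssytWeights (lam : List ℕ) (n : ℕ) :
    Multiset (MvPolynomial (Fin n) ℤ) :=
  ((Finset.univ : Finset ((i : Fin lam.length) → Fin (lam.get i) → Fin n)).filter
      (fun T =>
        (∀ (i : Fin lam.length) (j j' : Fin (lam.get i)), (j : ℕ) ≤ (j' : ℕ) → T i j ≤ T i j') ∧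
        (∀ (i i' : Fin lam.length), (i : ℕ) < (i' : ℕ) →
          ∀ (j : Fin (lam.get i')) (hj : (j : ℕ) < lam.get i), T i ⟨j, hj⟩ < T i' j))).val.map
    (fun T => ∑ i, ∑ j, MvPolynomial.X (T i j))

/-- Newton's identity in degree two: twice the second elementary symmetric function of a multiset
is the square of its sum minus the sum of its squares. -/
theorem Multiset.two_mul_esymm_two {R : Type*} [CommRing R] (s : Multiset R) :
    2 * s.esymm 2 = s.sum ^ 2 - (s.map (fun x => x ^ 2)).sum := by
  induction s using Multiset.induction_on with
  | empty => simp [Multiset.esymm, Multiset.powersetCard_zero_right]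
  | cons a s ih =>
    have h : (a ::ₘ s).esymm 2 = s.esymm 2 + a * s.sum := by
      simp [Multiset.esymm, Multiset.powersetCard_cons, Multiset.powersetCard_one,
        Multiset.map_map]
      simpa using Multiset.sum_map_mul_left (s := s) (a := a) (f := id)
    rw [h, mul_add, ih]
    simp only [Multiset.sum_cons, Multiset.map_cons]
    ring

/-- The multiset of weights of shape `(2, 1)`, indexed by the triples `(a, b, c)` of entries of the
tableaux with first row `a ≤ b` and second row `c > a`. -/
theorem ssytWeights_two_one (n : ℕ) :
    ssytWeights [2, 1] n =
      ((Finset.univ : Finset (Fin n × Fin n × Fin n)).filter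
        (fun t => t.1 ≤ t.2.1 ∧ t.1 < t.2.2)).val.map
        (fun t => X t.1 + X t.2.1 + X t.2.2) := by
  classical
  let T (t : Fin n × Fin n × Fin n) : (i : Fin [2, 1].length) → Fin ([2, 1].get i) → Fin n :=
    Fin.cons (α := fun i : Fin 2 => Fin ([2, 1].get i) → Fin n) ![t.1, t.2.1]
      (Fin.cons (α := fun i : Fin 1 => Fin ([2, 1].get i.succ) → Fin n) ![t.2.2] finZeroElim)
  refine Eq.symm (Multiset.map_eq_map_of_bij_of_nodup _ _ (Finset.nodup _) (Finset.nodup _)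
    (fun t _ => T t) ?_ ?_ ?_ ?_)
  · rintro ⟨a, b, c⟩ h
    simp only [Finset.mem_val, Finset.mem_filter, Finset.mem_univ, true_and] at h ⊢
    refine ⟨fun i j j' hj => ?_, fun i i' hi j hj => ?_⟩
    · match i, j, j', hj with
      | ⟨0, _⟩, ⟨0, _⟩, ⟨0, _⟩, _ => exact le_rfl
      | ⟨0, _⟩, ⟨0, _⟩, ⟨1, _⟩, _ => exact h.1
      | ⟨0, _⟩, ⟨1, _⟩, ⟨1, _⟩, _ => exact le_rfl
      | ⟨1, _⟩, ⟨0, _⟩, ⟨0, _⟩, _ => exact le_rfl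
    · match i, i', hi, j, hj with
      | ⟨0, _⟩, ⟨1, _⟩, _, ⟨0, _⟩, _ => exact h.2
      | ⟨k + 1, _⟩, ⟨l, hl⟩, hkl, _, _ =>
        change l < 2 at hl
        change k + 1 < l at hkl
        omega
  · rintro ⟨a, b, c⟩ - ⟨a', b', c'⟩ - h
    have h₁ : a = a' := congrFun (congrFun h 0) (0 : Fin 2)
    have h₂ : b = b' := congrFun (congrFun h 0) (1 : Fin 2)
    have h₃ : c = c' := congrFun (congrFun h 1) (0 : Fin 1)
    rw [h₁, h₂, h₃]
  · intro S h
    simp only [Finset.mem_val, Finset.mem_filter, Finset.mem_univ, true_and] at h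
    refine ⟨(S 0 (0 : Fin 2), S 0 (1 : Fin 2), S 1 (0 : Fin 1)), ?_, ?_⟩
    · simp only [Finset.mem_val, Finset.mem_filter, Finset.mem_univ, true_and]
      exact ⟨h.1 0 (0 : Fin 2) (1 : Fin 2) (by decide),
        h.2 0 1 (by decide) (0 : Fin 1) (by decide)⟩
    · funext i j
      match i, j with
      | ⟨0, _⟩, ⟨0, _⟩ => rfl
      | ⟨0, _⟩, ⟨1, _⟩ => rfl
      | ⟨1, _⟩, ⟨0, _⟩ => rfl
  · rintro ⟨a, b, c⟩ -
    change _ = ∑ i : Fin 2, ∑ j, X (T (a, b, c) i j)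
    rw [Fin.sum_univ_two]
    change _ = ∑ j : Fin 2, X (T (a, b, c) 0 j) + ∑ j : Fin 1, X (T (a, b, c) 1 j)
    rw [Fin.sum_univ_two, Fin.sum_univ_one]
    rfl

theorem sum_ssytWeights_two_one_six :
    (ssytWeights [2, 1] 6).sum = 35 * ∑ i, X i := by
  rw [ssytWeights_two_one]
  change ∑ t ∈ _, _ = _
  rw [Finset.sum_filter]
  simp [Fintype.sum_prod_type, Fin.sum_univ_six]
  ring

theorem sum_sq_ssytWeights_two_one_six :
    ((ssytWeights [2, 1] 6).map (fun w => w ^ 2)).sum =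
      12 * (∑ i, X i) ^ 2 + 33 * ∑ i, X i ^ 2 := by
  rw [ssytWeights_two_one, Multiset.map_map]
  change ∑ t ∈ _, _ = _
  rw [Finset.sum_filter]
  simp [Fintype.sum_prod_type, Fin.sum_univ_six]
  ring

/-- `c₂(γ6^[2, 1]) = 33·c₂(γ6)`: the second elementary symmetric function of
the multiset of weights of semistandard Young tableaux of shape `[2, 1]` with
entries in `{0, …, 5}` is congruent to `33·e₂` modulo the ideal generated
by `e₁`. -/
theorem c2_ssyt_stmt3 :
    Multiset.esymm (ssytWeights [2, 1] 6) 2 - 33 * esymm (Fin 6) ℤ 2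
      ∈ Ideal.span {esymm (Fin 6) ℤ 1} := by
  have hW := Multiset.two_mul_esymm_two (ssytWeights [2, 1] 6)
  rw [sum_ssytWeights_two_one_six, sum_sq_ssytWeights_two_one_six] at hW
  have hE := Multiset.two_mul_esymm_two
    ((Finset.univ : Finset (Fin 6)).val.map (X : Fin 6 → MvPolynomial (Fin 6) ℤ))
  rw [← esymm_eq_multiset_esymm, Multiset.map_map] at hE
  change 2 * esymm (Fin 6) ℤ 2 = (∑ i, X i) ^ 2 - ∑ i, X i ^ 2 at hE
  refine Ideal.mem_span_singleton.mpr ⟨590 * esymm (Fin 6) ℤ 1, ?_⟩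
  rw [esymm_one]
  refine mul_left_cancel₀ (two_ne_zero (α := MvPolynomial (Fin 6) ℤ)) ?_
  linear_combination hW - 33 * hE
end

section
/- In R = MvPolynomial (Fin 8) ℤ, the second elementary symmetric function of the multiset W((2,1,1,1,1), 8) of weights of semistandard Young tableaux of shape (2,1,1,1,1) with entries in {0,…,7} is congruent to 170·e₂ modulo the ideal generated by e₁; equivalently, c₂(γ₈^{(2,1,1,1,1)}) = 170·c₂(γ₈), the Table 1 entry for the weight α₁+α₅ of SL₈/μ₂. -/
open MvPolynomial

/-- Newton's identity in degree two for the elementary symmetric functions of a multiset. -/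
theorem Multiset.sum_sq_eq_sum_map_sq_add_two_mul_esymm_two {R : Type*} [CommRing R]
    (s : Multiset R) :
    s.sum ^ 2 = (s.map (fun x => x ^ 2)).sum + 2 * s.esymm 2 := by
  induction s using Multiset.induction_on with
  | empty => simp [Multiset.esymm, Multiset.powersetCard_zero_right]
  | cons a s ih =>
    have h : (a ::ₘ s).esymm 2 = s.esymm 2 + a * s.sum := by
      simp [Multiset.esymm, Multiset.powersetCard_cons, Multiset.powersetCard_one]
      simpa using Multiset.sum_map_mul_left (s := s) (a := a) (f := id)
    rw [h, Multiset.sum_cons, Multiset.map_cons, Multiset.sum_cons]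
    linear_combination ih

/-- Pairs of a `5`-subset (the first column of a tableau of shape `(2,1,1,1,1)`) and an element
(the remaining entry) which is at least the minimum of the subset. -/
def columnPairs : Finset (Finset (Fin 8) × Fin 8) :=
  ((Finset.powersetCard 5 Finset.univ) ×ˢ Finset.univ).filter (fun p => ∃ x ∈ p.1, x ≤ p.2)

/-- The multiplicity of the entry `i` in the tableau encoded by `p`. -/
def entryCount (p : Finset (Fin 8) × Fin 8) (i : Fin 8) : ℕ :=
  (if i ∈ p.1 then 1 else 0) + if i = p.2 then 1 else 0

theorem sum_entryCount : ∀ i, ∑ p ∈ columnPairs, entryCount p i = 315 := by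
  decide +kernel

theorem sum_entryCount_mul : ∀ i j, ∑ p ∈ columnPairs, entryCount p i * entryCount p j =
    (if i = j then 170 else 0) + 215 := by
  decide +kernel

set_option linter.constructorNameAsVariable false in
/-- Sums over tableaux of shape `(2,1,1,1,1)` are sums over their encodings by pairs. -/
theorem sum_map_ssytWeights {M : Type*} [AddCommMonoid M]
    (f : MvPolynomial (Fin 8) ℤ → M) :
    ((ssytWeights [2, 1, 1, 1, 1] 8).map f).sum =
      ∑ p ∈ columnPairs, f (∑ i, (entryCount p i : MvPolynomial (Fin 8) ℤ) * X i) := by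
  classical
  have hpos : ∀ i : Fin [2, 1, 1, 1, 1].length, 0 < [2, 1, 1, 1, 1].get i := by decide
  have hone : ∀ (i : Fin [2, 1, 1, 1, 1].length) (j : Fin ([2, 1, 1, 1, 1].get i)),
      (j : ℕ) = 0 ∨ ((i : ℕ) = 0 ∧ (j : ℕ) = 1) := by decide
  have hmono : ∀ T : (i : Fin [2, 1, 1, 1, 1].length) → Fin ([2, 1, 1, 1, 1].get i) → Fin 8,
      (∀ (i i' : Fin [2, 1, 1, 1, 1].length), (i : ℕ) < (i' : ℕ) →
        ∀ (j : Fin ([2, 1, 1, 1, 1].get i')) (hj : (j : ℕ) < [2, 1, 1, 1, 1].get i),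
          T i ⟨j, hj⟩ < T i' j) → StrictMono (fun i : Fin 5 => T i ⟨0, hpos i⟩) :=
    fun T hT i i' h => hT i i' h ⟨0, hpos i'⟩ (hpos i)
  rw [ssytWeights, Multiset.map_map, Finset.sum_map_val]
  refine Finset.sum_bij
    (fun T _ => (Finset.univ.image (fun i : Fin 5 => T i ⟨0, hpos i⟩), T 0 ⟨1, by decide⟩))
    ?_ ?_ ?_ ?_
  · intro T hT
    rw [Finset.mem_filter] at hT
    have hrow := hT.2.1
    have hcol := hT.2.2
    simp only [columnPairs, Finset.mem_filter, Finset.mem_product, Finset.mem_powersetCard,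
      Finset.mem_univ, and_true, Finset.subset_univ, true_and]
    refine ⟨?_, T 0 ⟨0, hpos 0⟩, Finset.mem_image_of_mem _ (Finset.mem_univ (0 : Fin 5)),
      hrow 0 _ _ (by simp)⟩
    rw [Finset.card_image_of_injective _ (hmono T hcol).injective]
    simp
  · intro T hT T' hT' h
    rw [Finset.mem_filter] at hT hT'
    have hm := hmono T hT.2.2
    have hm' := hmono T' hT'.2.2
    obtain ⟨h1, h2⟩ := Prod.mk.inj h
    have h3 := (StrictMono.range_inj hm hm').1 (by
      simpa using congrArg (fun s : Finset (Fin 8) => (s : Set (Fin 8))) h1)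
    funext i j
    rcases hone i j with hj | ⟨hi, hj⟩
    · obtain rfl : j = ⟨0, hpos i⟩ := Fin.ext hj
      exact congrFun h3 i
    · obtain rfl : i = 0 := Fin.ext hi
      obtain rfl : j = ⟨1, by decide⟩ := Fin.ext hj
      exact h2
  · rintro ⟨s, b⟩ hp
    simp only [columnPairs, Finset.mem_filter, Finset.mem_product, Finset.mem_powersetCard,
      Finset.mem_univ, and_true, Finset.subset_univ, true_and] at hp
    obtain ⟨hs, x, hx, hxb⟩ := hp
    have himage : Finset.univ.image (s.orderEmbOfFin hs) = s := by
      rw [← Finset.coe_inj]; simp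
    have hmin : s.orderEmbOfFin hs 0 ≤ b := by
      rw [← himage] at hx
      obtain ⟨k, -, rfl⟩ := Finset.mem_image.1 hx
      exact ((s.orderEmbOfFin hs).monotone (Fin.zero_le k)).trans hxb
    refine ⟨fun i j => if (j : ℕ) = 0 then s.orderEmbOfFin hs i else b, ?_, ?_⟩
    · simp only [Finset.mem_filter, Finset.mem_univ, true_and]
      refine And.intro ?_ ?_
      · intro i j j' hjj
        rcases hone i j with hj | ⟨hi, hj⟩
        · rcases hone i j' with hj' | ⟨hi', hj'⟩
          · simp [hj, hj']
          · obtain rfl : i = 0 := Fin.ext hi'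
            simpa [hj, hj'] using hmin
        · have : (j' : ℕ) ≠ 0 := by omega
          simp [hj, this]
      · intro i i' hii j hj
        have hj0 : (j : ℕ) = 0 := by
          rcases hone i' j with h | ⟨h, -⟩ <;> omega
        simp only [hj0, if_true]
        exact (s.orderEmbOfFin hs).strictMono hii
    · simp [himage]
  · intro T hT
    rw [Finset.mem_filter] at hT
    have hinj := (hmono T hT.2.2).injective
    simp only [Function.comp_apply]
    congr 1
    simp only [entryCount, Nat.cast_add, Nat.cast_ite, Nat.cast_one, Nat.cast_zero, add_mul,
      ite_mul, one_mul, zero_mul, Finset.sum_add_distrib, Finset.sum_ite_mem,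
      Finset.univ_inter, Finset.sum_ite_eq', Finset.mem_univ, if_true]
    rw [Finset.sum_image hinj.injOn]
    change ∑ i : Fin 5, ∑ j : Fin ([2, 1, 1, 1, 1].get i), X (T i j) = _
    simp only [Fin.sum_univ_five]
    change (∑ j : Fin 2, X (T 0 j)) + (∑ j : Fin 1, X (T 1 j)) + (∑ j : Fin 1, X (T 2 j))
      + (∑ j : Fin 1, X (T 3 j)) + (∑ j : Fin 1, X (T 4 j)) = _
    simp only [Fin.sum_univ_two, Fin.sum_univ_one]
    change (X (T 0 ⟨0, hpos 0⟩) + X (T 0 ⟨1, by decide⟩)) + X (T 1 ⟨0, hpos 1⟩)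
      + X (T 2 ⟨0, hpos 2⟩) + X (T 3 ⟨0, hpos 3⟩) + X (T 4 ⟨0, hpos 4⟩) = _
    ring

theorem sum_ssytWeights :
    (ssytWeights [2, 1, 1, 1, 1] 8).sum = 315 * ∑ i, X i := by
  have h := sum_map_ssytWeights id
  rw [Multiset.map_id] at h
  simp only [id] at h
  rw [h, Finset.sum_comm, Finset.mul_sum]
  refine Finset.sum_congr rfl fun i _ => ?_
  rw [← Finset.sum_mul, ← Nat.cast_sum, sum_entryCount]
  norm_num

theorem sum_sq_ssytWeights :
    ((ssytWeights [2, 1, 1, 1, 1] 8).map (fun x => x ^ 2)).sum =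
      170 * ∑ i, X i ^ 2 + 215 * (∑ i, X i) ^ 2 := by
  have h : ∀ i j : Fin 8, ∑ p ∈ columnPairs,
      ((entryCount p i : MvPolynomial (Fin 8) ℤ) * X i) *
        ((entryCount p j : MvPolynomial (Fin 8) ℤ) * X j) =
        (if i = j then 170 * X i ^ 2 else 0) + 215 * (X i * X j) := by
    intro i j
    have hc := congrArg (Nat.cast (R := MvPolynomial (Fin 8) ℤ)) (sum_entryCount_mul i j)
    push_cast at hc
    rw [Finset.sum_congr rfl fun p _ => mul_mul_mul_comm _ _ _ _, ← Finset.sum_mul, hc]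
    split_ifs with hij
    · subst hij; ring
    · ring
  rw [sum_map_ssytWeights]
  simp_rw [sq (∑ i, _), Finset.sum_mul_sum]
  rw [Finset.sum_comm]
  simp_rw [Finset.sum_comm (s := columnPairs), h, Finset.sum_add_distrib, Finset.mul_sum]
  simp

/-- `c₂(γ8^[2, 1, 1, 1, 1]) = 170·c₂(γ8)`: the second elementary symmetric function of
the multiset of weights of semistandard Young tableaux of shape `[2, 1, 1, 1, 1]` with
entries in `{0, …, 7}` is congruent to `170·e₂` modulo the ideal generated
by `e₁`. -/
theorem c2_ssyt_stmt8 :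
    Multiset.esymm (ssytWeights [2, 1, 1, 1, 1] 8) 2 - 170 * esymm (Fin 8) ℤ 2
      ∈ Ideal.span {esymm (Fin 8) ℤ 1} := by
  have hW := Multiset.sum_sq_eq_sum_map_sq_add_two_mul_esymm_two (ssytWeights [2, 1, 1, 1, 1] 8)
  have hX := Multiset.sum_sq_eq_sum_map_sq_add_two_mul_esymm_two
    (Finset.univ.val.map (X : Fin 8 → MvPolynomial (Fin 8) ℤ))
  rw [← MvPolynomial.esymm_eq_multiset_esymm, Multiset.map_map] at hX
  change (∑ i, X i) ^ 2 = ∑ i, X i ^ 2 + 2 * esymm (Fin 8) ℤ 2 at hX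
  rw [sum_ssytWeights, sum_sq_ssytWeights] at hW
  rw [Ideal.mem_span_singleton, esymm_one]
  refine ⟨49420 * ∑ i, X i, mul_left_cancel₀ (two_ne_zero (α := MvPolynomial (Fin 8) ℤ)) ?_⟩
  linear_combination 170 * hX - hW
end
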